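/- For 0 < |q| < 1: ∑_{n=1}^{∞} (−q; q)_{n−1} q^{(3n² − n)/2} / [(1 + q^n)(q; q)_{2n−1}] = −[1/φ(−q)] ∑_{n∈ℤ} [(1 − q^{3n})/(1 + q^{3n})] q^{(15n² + n)/2} + [1/φ(−q)] ∑_{n∈ℤ} [(1 − q^{3n+1})/(1 + q^{3n+1})] q^{(15n² + 11n)/2 + 1}, where φ(−q) = (q;q)_∞ / (−q;q)_∞. -/

import Mathlib

noncomputable def qp (q x : ℂ) (n : ℕ) : ℂ := ∏ i ∈ Finset.range n, (1 - x * q ^ i)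

noncomputable def qpInf (q x : ℂ) : ℂ := ∏' i : ℕ, (1 - x * q ^ i)

open Filter Topology

/-- `1/(q;q)_n`, extended by zero to negative `n`. -/
noncomputable def rq (q : ℂ) (n : ℤ) : ℂ := if n < 0 then 0 else (qp q q n.toNat)⁻¹

lemma one_sub_pow_ne {q : ℂ} (h1 : ‖q‖ < 1) (n : ℕ) : 1 - q * q ^ n ≠ 0 := by
  intro h
  have h2 : q ^ (n + 1) = 1 := by rw [pow_succ']; exact (sub_eq_zero.mp h).symm
  have h3 : ‖q‖ ^ (n + 1) = 1 := by rw [← norm_pow, h2, norm_one]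
  have h4 : ‖q‖ ^ (n + 1) < 1 := pow_lt_one₀ (norm_nonneg _) h1 (by omega)
  linarith

lemma qp_ne {q : ℂ} (h1 : ‖q‖ < 1) (n : ℕ) : qp q q n ≠ 0 :=
  Finset.prod_ne_zero_iff.mpr fun i _ => one_sub_pow_ne h1 i

lemma rq_neg (q : ℂ) {n : ℤ} (h : n < 0) : rq q n = 0 := if_pos h

lemma rq_nat (q : ℂ) (n : ℕ) : rq q n = (qp q q n)⁻¹ := by simp [rq]

lemma rq_pred {q : ℂ} (h1 : ‖q‖ < 1) (n : ℤ) : rq q (n - 1) = (1 - q ^ n) * rq q n := by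
  rcases lt_trichotomy n 0 with h | h | h
  · rw [rq_neg q h, rq_neg q (by omega), mul_zero]
  · subst h; rw [rq_neg q (by omega)]; simp
  · obtain ⟨m, rfl⟩ : ∃ m : ℕ, n = m + 1 := ⟨(n - 1).toNat, by omega⟩
    have e : rq q ((m : ℤ) + 1) = (qp q q (m + 1))⁻¹ := by
      rw [← rq_nat]; push_cast; rfl
    rw [add_sub_cancel_right, rq_nat, e, qp, qp, Finset.prod_range_succ]
    have h2 := one_sub_pow_ne h1 m
    have h3 := qp_ne h1 m
    rw [qp] at h3
    have e2 : q ^ ((m : ℤ) + 1) = q * q ^ m := by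
      rw [← pow_succ']; exact_mod_cast rfl
    rw [e2]
    field_simp

lemma summable_geo {q : ℂ} (h1 : ‖q‖ < 1) (x : ℂ) : Summable fun i : ℕ => ‖-(x * q ^ i)‖ := by
  simp only [norm_neg, norm_mul, norm_pow]
  exact (summable_geometric_of_lt_one (norm_nonneg _) h1).mul_left _

lemma qp_tendsto {q : ℂ} (h1 : ‖q‖ < 1) (x : ℂ) :
    Tendsto (fun n => qp q x n) atTop (𝓝 (qpInf q x)) := by
  have := (multipliable_one_add_of_summable (summable_geo h1 x)).hasProd.tendsto_prod_nat
  simp only [← sub_eq_add_neg] at this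
  exact this

lemma qpInf_ne {q : ℂ} (h1 : ‖q‖ < 1) : qpInf q q ≠ 0 := by
  have := tprod_one_add_ne_zero_of_summable (f := fun i : ℕ => -(q * q ^ i))
    (fun i => by simpa only [← sub_eq_add_neg] using one_sub_pow_ne h1 i) (summable_geo h1 q)
  simp only [← sub_eq_add_neg] at this
  exact this

lemma bdd_of_tendsto {u : ℕ → ℂ} {x : ℂ} (h : Tendsto u atTop (𝓝 x)) :
    ∃ K : ℝ, 0 < K ∧ ∀ n, ‖u n‖ ≤ K := by
  obtain ⟨C, hC⟩ := (Metric.isBounded_range_of_tendsto u h).exists_norm_le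
  exact ⟨max C 1, by positivity, fun n => (hC _ ⟨n, rfl⟩).trans (le_max_left _ _)⟩

lemma rq_tendsto {q : ℂ} (h1 : ‖q‖ < 1) :
    Tendsto (fun n : ℕ => rq q n) atTop (𝓝 (qpInf q q)⁻¹) := by
  simp only [rq_nat]
  exact (qp_tendsto h1 q).inv₀ (qpInf_ne h1)

lemma rq_bdd {q : ℂ} (h1 : ‖q‖ < 1) : ∃ K : ℝ, 0 < K ∧ ∀ n, ‖rq q n‖ ≤ K := by
  obtain ⟨K, hK, h⟩ := bdd_of_tendsto (rq_tendsto h1)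
  refine ⟨K, hK, fun n => ?_⟩
  rcases lt_or_ge n 0 with h' | h'
  · rw [rq_neg q h', norm_zero]; exact hK.le
  · lift n to ℕ using h'; exact h n

lemma qp_bdd {q : ℂ} (h1 : ‖q‖ < 1) (x : ℂ) : ∃ K : ℝ, 0 < K ∧ ∀ n, ‖qp q x n‖ ≤ K :=
  bdd_of_tendsto (qp_tendsto h1 x)

lemma rqrq_zero (q : ℂ) {a b : ℤ} (h : a < 0 ∨ b < 0) : rq q a * rq q b = 0 := by
  rcases h with h | h <;> simp [rq_neg q h]

lemma sumP (q : ℂ) (c : ℤ → ℂ) (a b : ℤ) :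
    Summable fun j : ℤ => c j * (rq q (a - 3 * j) * rq q (b + 3 * j)) := by
  apply summable_of_ne_finset_zero (s := Finset.Icc (-|b|) |a|)
  intro j hj
  rw [rqrq_zero, mul_zero]
  by_contra hc
  push Not at hc
  apply hj
  rw [Finset.mem_Icc]
  have := le_abs_self a
  have := le_abs_self b
  have := abs_nonneg a
  have := abs_nonneg b
  omega

lemma tsum_shift_sub {H : ℤ → ℂ} (h : Summable H) : ∑' j, (H j - H (j + 1)) = 0 := by
  have h2 : Summable fun j => H (j + 1) := (Equiv.addRight (1 : ℤ)).summable_iff.mpr h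
  rw [h.tsum_sub h2, (Equiv.addRight (1 : ℤ)).tsum_eq H |> fun e => (show ∑' j, H (j+1) = _ from e), sub_self]

noncomputable def D5 (q : ℂ) (n j : ℤ) : ℂ :=
  q ^ (3 * j ^ 2 + j) * (rq q (n - 3 * j) * rq q (n + 3 * j)) -
    q ^ (3 * j ^ 2 + j) * (rq q (n - 1 - 3 * j) * rq q (n + 1 + 3 * j))
noncomputable def D7 (q : ℂ) (n j : ℤ) : ℂ :=
  q ^ (3 * j ^ 2 - 2 * j) * (rq q (n - 3 * j) * rq q (n + 3 * j)) -
    q ^ (3 * j ^ 2 + 4 * j + 1) * (rq q (n - 1 - 3 * j) * rq q (n + 1 + 3 * j))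
noncomputable def DO (q : ℂ) (n j : ℤ) : ℂ :=
  q ^ (3 * j ^ 2 - 2 * j) * (rq q (n - 3 * j) * rq q (n - 1 + 3 * j)) -
    q ^ (3 * j ^ 2 + 4 * j + 1) * (rq q (n - 2 - 3 * j) * rq q (n + 1 + 3 * j))

lemma D5_step {q : ℂ} (hq : q ≠ 0) (h1 : ‖q‖ < 1) (n j : ℤ) :
    (1 - q ^ (2 * n)) * D5 q n j = q ^ n * DO q n j := by
  have e1 : rq q (n - 1 - 3 * j) = (1 - q ^ (n - 3 * j)) * rq q (n - 3 * j) := by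
    rw [← rq_pred h1]; congr 1; ring
  have e2 : rq q (n - 2 - 3 * j) = (1 - q ^ (n - 1 - 3 * j)) * rq q (n - 1 - 3 * j) := by
    rw [← rq_pred h1]; congr 1; ring
  have e3 : rq q (n + 3 * j) = (1 - q ^ (n + 1 + 3 * j)) * rq q (n + 1 + 3 * j) := by
    rw [← rq_pred h1]; congr 1; ring
  have e4 : rq q (n - 1 + 3 * j) = (1 - q ^ (n + 3 * j)) * rq q (n + 3 * j) := by
    rw [← rq_pred h1]; congr 1; ring
  rw [D5, DO, e2, e1, e4, e3]
  have hn := zpow_ne_zero n hq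
  have hj := zpow_ne_zero j hq
  have hj2 := zpow_ne_zero (j ^ 2) hq
  simp only [zpow_add₀ hq, zpow_sub₀ hq, mul_comm _ n, mul_comm _ j, mul_comm _ (j ^ 2), zpow_mul, zpow_ofNat]
  generalize q ^ n = x at *
  generalize q ^ j = y at *
  generalize q ^ (j ^ 2) = z at *
  field_simp
  ring

lemma D7_step {q : ℂ} (hq : q ≠ 0) (h1 : ‖q‖ < 1) (n j : ℤ) :
    (1 - q ^ (2 * n)) * D7 q n j = DO q n j := by
  have e1 : rq q (n - 1 - 3 * j) = (1 - q ^ (n - 3 * j)) * rq q (n - 3 * j) := by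
    rw [← rq_pred h1]; congr 1; ring
  have e2 : rq q (n - 2 - 3 * j) = (1 - q ^ (n - 1 - 3 * j)) * rq q (n - 1 - 3 * j) := by
    rw [← rq_pred h1]; congr 1; ring
  have e3 : rq q (n + 3 * j) = (1 - q ^ (n + 1 + 3 * j)) * rq q (n + 1 + 3 * j) := by
    rw [← rq_pred h1]; congr 1; ring
  have e4 : rq q (n - 1 + 3 * j) = (1 - q ^ (n + 3 * j)) * rq q (n + 3 * j) := by
    rw [← rq_pred h1]; congr 1; ring
  rw [D7, DO, e2, e1, e4, e3]
  have hn := zpow_ne_zero n hq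
  have hj := zpow_ne_zero j hq
  have hj2 := zpow_ne_zero (j ^ 2) hq
  simp only [zpow_add₀ hq, zpow_sub₀ hq, mul_comm _ n, mul_comm _ j, mul_comm _ (j ^ 2), zpow_mul, zpow_ofNat]
  generalize q ^ n = x at *
  generalize q ^ j = y at *
  generalize q ^ (j ^ 2) = z at *
  field_simp
  ring

noncomputable def HO (q : ℂ) (n j : ℤ) : ℂ :=
  q ^ (3 * j ^ 2 - 2 * j) * (rq q (n - 3 * j) * rq q (n - 2 + 3 * j))

lemma DO_step {q : ℂ} (hq : q ≠ 0) (h1 : ‖q‖ < 1) (n j : ℤ) :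
    (1 - q ^ (2 * n - 1)) * DO q n j
      = q ^ (n - 1) * D5 q (n - 1) j + (HO q n j - HO q n (j + 1)) := by
  have e1 : rq q (n - 1 - 3 * j) = (1 - q ^ (n - 3 * j)) * rq q (n - 3 * j) := by
    rw [← rq_pred h1]; congr 1; ring
  have e2 : rq q (n - 2 - 3 * j) = (1 - q ^ (n - 1 - 3 * j)) * rq q (n - 1 - 3 * j) := by
    rw [← rq_pred h1]; congr 1; ring
  have e2' : rq q (n - 3 * (j + 1)) = (1 - q ^ (n - 2 - 3 * j)) * rq q (n - 2 - 3 * j) := by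
    rw [← rq_pred h1]; congr 1; ring
  have e3 : rq q (n + 3 * j) = (1 - q ^ (n + 1 + 3 * j)) * rq q (n + 1 + 3 * j) := by
    rw [← rq_pred h1]; congr 1; ring
  have e4 : rq q (n - 1 + 3 * j) = (1 - q ^ (n + 3 * j)) * rq q (n + 3 * j) := by
    rw [← rq_pred h1]; congr 1; ring
  have e5 : rq q (n - 2 + 3 * j) = (1 - q ^ (n - 1 + 3 * j)) * rq q (n - 1 + 3 * j) := by
    rw [← rq_pred h1]; congr 1; ring
  rw [D5, DO, HO, HO, e2', show n - 2 + 3 * (j + 1) = n + 1 + 3 * j by ring,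
    show n - 1 - 1 - 3 * j = n - 2 - 3 * j by ring,
    show n - 1 + 1 + 3 * j = n + 3 * j by ring,
    show 3 * (j + 1) ^ 2 - 2 * (j + 1) = 3 * j ^ 2 + 4 * j + 1 by ring, e5, e2, e1, e4, e3]
  have hn := zpow_ne_zero n hq
  have hj := zpow_ne_zero j hq
  have hj2 := zpow_ne_zero (j ^ 2) hq
  simp only [zpow_add₀ hq, zpow_sub₀ hq, mul_comm _ n, mul_comm _ j, mul_comm _ (j ^ 2), zpow_mul, zpow_ofNat]
  generalize q ^ n = x at *
  generalize q ^ j = y at *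
  generalize q ^ (j ^ 2) = z at *
  field_simp
  ring

lemma sum_D5 (q : ℂ) (n : ℤ) : Summable (D5 q n) :=
  (sumP q (fun j => q ^ (3 * j ^ 2 + j)) n n).sub
    (sumP q (fun j => q ^ (3 * j ^ 2 + j)) (n - 1) (n + 1))

lemma sum_D7 (q : ℂ) (n : ℤ) : Summable (D7 q n) :=
  (sumP q (fun j => q ^ (3 * j ^ 2 - 2 * j)) n n).sub
    (sumP q (fun j => q ^ (3 * j ^ 2 + 4 * j + 1)) (n - 1) (n + 1))

lemma sum_HO (q : ℂ) (n : ℤ) : Summable (HO q n) :=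
  sumP q (fun j => q ^ (3 * j ^ 2 - 2 * j)) n (n - 2)

lemma t5 {q : ℂ} (hq : q ≠ 0) (h1 : ‖q‖ < 1) (n : ℤ) :
    (1 - q ^ (2 * n)) * ∑' j, D5 q n j = q ^ n * ∑' j, DO q n j := by
  rw [← tsum_mul_left, ← tsum_mul_left]
  exact tsum_congr (D5_step hq h1 n)

lemma t7 {q : ℂ} (hq : q ≠ 0) (h1 : ‖q‖ < 1) (n : ℤ) :
    (1 - q ^ (2 * n)) * ∑' j, D7 q n j = ∑' j, DO q n j := by
  rw [← tsum_mul_left]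
  exact tsum_congr (D7_step hq h1 n)

lemma tO {q : ℂ} (hq : q ≠ 0) (h1 : ‖q‖ < 1) (n : ℤ) :
    (1 - q ^ (2 * n - 1)) * ∑' j, DO q n j = q ^ (n - 1) * ∑' j, D5 q (n - 1) j := by
  have hs : Summable fun j => HO q n (j + 1) :=
    (Equiv.addRight (1 : ℤ)).summable_iff.mpr (sum_HO q n)
  rw [← tsum_mul_left, tsum_congr (DO_step hq h1 n),
    ((sum_D5 q (n - 1)).mul_left _).tsum_add ((sum_HO q n).sub hs), tsum_shift_sub (sum_HO q n),
    add_zero, tsum_mul_left]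

lemma one_sub_zpow_ne {q : ℂ} (h1 : ‖q‖ < 1) {n : ℤ} (hn : 0 < n) : 1 - q ^ n ≠ 0 := by
  obtain ⟨m, rfl⟩ : ∃ m : ℕ, n = ((m + 1 : ℕ) : ℤ) := ⟨(n - 1).toNat, by omega⟩
  rw [zpow_natCast, pow_succ']
  exact one_sub_pow_ne h1 m

lemma v5 {q : ℂ} (hq : q ≠ 0) (h1 : ‖q‖ < 1) (n : ℕ) :
    ∑' j, D5 q n j = q ^ ((n : ℤ) ^ 2) * rq q (2 * n) := by
  induction n with
  | zero =>
    rw [tsum_eq_single 0]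
    · simp [D5, rq_neg, rq, qp]
    · intro j hj
      rw [D5, rqrq_zero, rqrq_zero]
      · simp
      · push_cast; omega
      · push_cast; omega
  | succ n ih =>
    have a := t5 hq h1 (n + 1)
    have b := tO hq h1 (n + 1)
    rw [add_sub_cancel_right, ih] at b
    have c1 := one_sub_zpow_ne h1 (n := 2 * ((n : ℤ) + 1)) (by omega)
    have c2 := one_sub_zpow_ne h1 (n := 2 * ((n : ℤ) + 1) - 1) (by omega)
    have e1 := rq_pred h1 (2 * ((n : ℤ) + 1) - 1)
    have e2 := rq_pred h1 (2 * ((n : ℤ) + 1))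
    rw [show 2 * ((n : ℤ) + 1) - 1 - 1 = 2 * n by ring, e2] at e1
    push_cast
    apply mul_left_cancel₀ c2
    apply mul_left_cancel₀ c1
    rw [mul_left_comm, a, mul_left_comm, b, e1]
    rw [show ((n : ℤ) + 1) ^ 2 = (n + 1) + n + n ^ 2 by ring, zpow_add₀ hq ((n : ℤ) + 1 + n),
      zpow_add₀ hq ((n : ℤ) + 1) n]
    ring

lemma vO {q : ℂ} (hq : q ≠ 0) (h1 : ‖q‖ < 1) (n : ℕ) (hn : 0 < n) :
    ∑' j, DO q n j = (1 - q ^ (2 * (n : ℤ))) * (q ^ ((n : ℤ) ^ 2 - n) * rq q (2 * n)) := by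
  have a := t5 hq h1 n
  rw [v5 hq h1] at a
  have := zpow_ne_zero (n : ℤ) hq
  apply mul_left_cancel₀ this
  rw [← a, zpow_sub₀ hq]
  field_simp

lemma v7 {q : ℂ} (hq : q ≠ 0) (h1 : ‖q‖ < 1) (n : ℕ) (hn : 0 < n) :
    ∑' j, D7 q n j = q ^ ((n : ℤ) ^ 2 - n) * rq q (2 * n) := by
  have a := t7 hq h1 n
  rw [vO hq h1 n hn] at a
  exact mul_left_cancel₀ (one_sub_zpow_ne h1 (by omega)) a

noncomputable def a3 (q : ℂ) (j : ℤ) : ℂ := q ^ (3 * j ^ 2 + 2 * j) - q ^ (3 * j ^ 2 - j)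
noncomputable def b3 (q : ℂ) (j : ℤ) : ℂ := q ^ (3 * j ^ 2 + j) - q ^ (3 * j ^ 2 + 4 * j + 1)

lemma bailey {q : ℂ} (hq : q ≠ 0) (h1 : ‖q‖ < 1) (n : ℕ) :
    ∑' j : ℤ, a3 q j * (rq q (n - 3 * j) * rq q (n + 3 * j))
      + ∑' j : ℤ, b3 q j * (rq q (n - (3 * j + 1)) * rq q (n + (3 * j + 1)))
      = q ^ ((n : ℤ) ^ 2 - n) * (1 - q ^ n) * rq q (2 * n) := by
  rcases Nat.eq_zero_or_pos n with rfl | hn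
  · have z1 : ∀ j : ℤ, a3 q j * (rq q ((0 : ℕ) - 3 * j) * rq q ((0 : ℕ) + 3 * j)) = 0 := by
      intro j
      by_cases hj : j = 0
      · subst hj; simp [a3]
      · rw [rqrq_zero, mul_zero]; push_cast; omega
    have z2 : ∀ j : ℤ, b3 q j *
        (rq q ((0 : ℕ) - (3 * j + 1)) * rq q ((0 : ℕ) + (3 * j + 1))) = 0 := by
      intro j
      rw [rqrq_zero, mul_zero]; push_cast; omega
    simp only [z1, z2, tsum_zero]
    simp
  · have r1 : ∑' j : ℤ, a3 q j * (rq q (n - 3 * j) * rq q (n + 3 * j)) =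
        ∑' j : ℤ, (q ^ (3 * j ^ 2 - 2 * j) - q ^ (3 * j ^ 2 + j)) *
          (rq q (n - 3 * j) * rq q (n + 3 * j)) := by
      rw [← (Equiv.neg ℤ).tsum_eq]
      refine tsum_congr fun j => ?_
      simp only [Equiv.neg_apply, a3]
      rw [show (n : ℤ) - 3 * -j = n + 3 * j by ring, show (n : ℤ) + 3 * -j = n - 3 * j by ring,
        show 3 * (-j) ^ 2 + 2 * -j = 3 * j ^ 2 - 2 * j by ring,
        show 3 * (-j) ^ 2 - -j = 3 * j ^ 2 + j by ring]
      ring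
    have r2 : ∀ j : ℤ, b3 q j * (rq q (n - (3 * j + 1)) * rq q (n + (3 * j + 1))) =
        b3 q j * (rq q ((n - 1 : ℤ) - 3 * j) * rq q ((n + 1 : ℤ) + 3 * j)) := by
      intro j
      rw [show (n : ℤ) - (3 * j + 1) = n - 1 - 3 * j by ring,
        show (n : ℤ) + (3 * j + 1) = n + 1 + 3 * j by ring]
    rw [r1, tsum_congr r2, ← (sumP q _ n n).tsum_add (sumP q _ (n - 1) (n + 1))]
    have : ∀ j : ℤ, (q ^ (3 * j ^ 2 - 2 * j) - q ^ (3 * j ^ 2 + j)) *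
          (rq q (n - 3 * j) * rq q (n + 3 * j)) +
        b3 q j * (rq q ((n - 1 : ℤ) - 3 * j) * rq q ((n + 1 : ℤ) + 3 * j))
        = D7 q n j - D5 q n j := by
      intro j; rw [D7, D5, b3]; ring
    rw [tsum_congr this, (sum_D7 q n).tsum_sub (sum_D5 q n), v5 hq h1, v7 hq h1 n hn,
      zpow_sub₀ hq]
    have := pow_ne_zero n hq
    rw [zpow_natCast]
    field_simp

lemma tri2 (n : ℕ) : n * (n + 1) / 2 * 2 = n * (n + 1) :=
  Nat.div_mul_cancel (Nat.even_mul_succ_self n).two_dvd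

lemma tri_add (r m : ℕ) :
    (r + m) * (r + m + 1) / 2 = r * (r + 1) / 2 + (m * (m + 1) / 2 + r * m) := by
  have a := tri2 r
  have b := tri2 m
  have c := tri2 (r + m)
  nlinarith

lemma le_tri (n : ℕ) : n ≤ n * (n + 1) / 2 := by
  have c := tri2 n
  rcases Nat.eq_zero_or_pos n with rfl | h
  · simp
  · nlinarith

noncomputable def w (q : ℂ) (n : ℕ) : ℂ := qp q (-1) n * q ^ (n * (n + 1) / 2)

lemma w_succ (q : ℂ) (n : ℕ) : w q (n + 1) = w q n * ((1 + q ^ n) * q ^ (n + 1)) := by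
  rw [w, w, tri_add n 1, qp, qp, Finset.prod_range_succ, pow_add]
  norm_num
  ring

lemma w_bdd {q : ℂ} (h1 : ‖q‖ < 1) : ∃ K : ℝ, 0 < K ∧ ∀ n, ‖w q n‖ ≤ K * ‖q‖ ^ n := by
  obtain ⟨K, hK, h⟩ := qp_bdd h1 (-1)
  refine ⟨K, hK, fun n => ?_⟩
  rw [w, norm_mul, norm_pow]
  exact mul_le_mul (h n) (pow_le_pow_of_le_one (norm_nonneg _) h1.le (le_tri n))
    (by positivity) hK.le

lemma sum_w {q : ℂ} (h1 : ‖q‖ < 1) (a b : ℤ) :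
    Summable fun n : ℕ => w q n * (rq q (n - a) * rq q (n + b)) := by
  obtain ⟨K, hK, h⟩ := w_bdd h1
  obtain ⟨M, hM, h'⟩ := rq_bdd h1
  refine Summable.of_norm_bounded
    (((summable_geometric_of_lt_one (norm_nonneg q) h1).mul_left K).mul_right (M * M)) fun n => ?_
  rw [norm_mul, norm_mul]
  exact mul_le_mul (h n) (mul_le_mul (h' _) (h' _) (norm_nonneg _) hM.le) (by positivity)
    (by positivity)

noncomputable def S (q : ℂ) (r : ℤ) : ℂ := ∑' n : ℕ, w q n * (rq q (n - r) * rq q (n + r))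

lemma wz {q : ℂ} (hq : q ≠ 0) (h1 : ‖q‖ < 1) (r : ℤ) (n : ℕ) :
    (1 + q ^ (r + 1)) * (w q n * (rq q (n - (r + 1)) * rq q (n + (r + 1))))
      - q ^ (r + 1) * (1 + q ^ r) * (w q n * (rq q (n - r) * rq q (n + r)))
    = (1 - q ^ (2 * r + 1)) * (w q n * (rq q (n - (r + 1)) * rq q (n + r))
      - w q (n + 1) * (rq q ((n + 1 : ℕ) - (r + 1)) * rq q ((n + 1 : ℕ) + r))) := by
  have e1 : rq q (n - (r + 1)) = (1 - q ^ (n - r)) * rq q (n - r) := by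
    rw [← rq_pred h1]; congr 1; ring
  have e2 : rq q (n + r) = (1 - q ^ (n + (r + 1))) * rq q (n + (r + 1)) := by
    rw [← rq_pred h1]; congr 1; ring
  rw [show ((n + 1 : ℕ) : ℤ) - (r + 1) = n - r by push_cast; ring,
    show ((n + 1 : ℕ) : ℤ) + r = n + (r + 1) by push_cast; ring, e1, e2, w_succ]
  have hn := pow_ne_zero n hq
  have hr := zpow_ne_zero r hq
  simp only [zpow_add₀ hq, zpow_sub₀ hq, zpow_one, zpow_natCast, mul_comm _ r, zpow_mul,
    zpow_ofNat, pow_succ]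
  generalize q ^ n = x at *
  generalize q ^ r = y at *
  field_simp
  ring

lemma S_step {q : ℂ} (hq : q ≠ 0) (h1 : ‖q‖ < 1) (r : ℤ) :
    (1 + q ^ (r + 1)) * S q (r + 1) = q ^ (r + 1) * (1 + q ^ r) * S q r := by
  rw [← sub_eq_zero, S, S, ← tsum_mul_left, ← tsum_mul_left,
    ← ((sum_w h1 (r + 1) (r + 1)).mul_left _).tsum_sub ((sum_w h1 r r).mul_left _),
    tsum_congr (wz hq h1 r), tsum_mul_left]
  have hs := sum_w h1 (r + 1) r
  have hs' := (summable_nat_add_iff 1).mpr hs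
  rw [hs.tsum_sub hs', hs.tsum_eq_zero_add, rqrq_zero q (by push_cast; omega)]
  simp

noncomputable def T (q : ℂ) (r : ℤ) : ℂ := (1 + q ^ r) * S q r / q ^ (r * (r + 1) / 2)

lemma T_step {q : ℂ} (hq : q ≠ 0) (h1 : ‖q‖ < 1) (r : ℤ) : T q (r + 1) = T q r := by
  rw [T, T, S_step hq h1, show (r + 1) * (r + 1 + 1) / 2 = r * (r + 1) / 2 + (r + 1) by
    rw [show (r + 1) * (r + 1 + 1) = r * (r + 1) + (r + 1) * 2 by ring,
      Int.add_mul_ediv_right _ _ (by norm_num)], zpow_add₀ hq (r * (r + 1) / 2)]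
  have := zpow_ne_zero (r + 1) hq
  have := zpow_ne_zero (r * (r + 1) / 2) hq
  field_simp

lemma T_const {q : ℂ} (hq : q ≠ 0) (h1 : ‖q‖ < 1) (r : ℤ) : T q r = T q 0 := by
  induction r using Int.induction_on with
  | zero => rfl
  | succ i ih => rw [T_step hq h1, ih]
  | pred i ih => rw [← ih, ← T_step hq h1 (-i - 1)]; congr 1; ring

lemma T_nat {q : ℂ} (hq : q ≠ 0) (h1 : ‖q‖ < 1) (r : ℕ) :
    T q r = (1 + q ^ r) * ∑' m : ℕ, (q ^ r) ^ m *
      (qp q (-1) (m + r) * q ^ (m * (m + 1) / 2) * rq q m * rq q ((m + 2 * r : ℕ) : ℤ)) := by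
  have hs := sum_w h1 (r : ℤ) r
  rw [T, S, ← hs.sum_add_tsum_nat_add r, Finset.sum_eq_zero, zero_add, zpow_natCast, mul_div_assoc,
    ← tsum_div_const]
  · congr 1
    refine tsum_congr fun m => ?_
    have e : (r : ℤ) * (r + 1) / 2 = (r * (r + 1) / 2 : ℕ) := by push_cast; rfl
    rw [w, e, zpow_natCast, add_comm m r, tri_add, pow_add, pow_add, pow_mul]
    have := pow_ne_zero (r * (r + 1) / 2) hq
    rw [show ((r + m : ℕ) : ℤ) - r = m by push_cast; ring,
      show ((r + m : ℕ) : ℤ) + r = (m + 2 * r : ℕ) by push_cast; ring]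
    field_simp
  · intro i hi
    rw [Finset.mem_range] at hi
    rw [rqrq_zero, mul_zero]
    omega

lemma T_lim {q : ℂ} (hq : q ≠ 0) (h1 : ‖q‖ < 1) :
    Tendsto (fun r : ℕ => T q r) atTop (𝓝 (qpInf q (-1) * (qpInf q q)⁻¹)) := by
  have hq0 : Tendsto (fun r : ℕ => q ^ r) atTop (𝓝 0) := tendsto_pow_atTop_nhds_zero_of_norm_lt_one h1
  obtain ⟨K, hK, h⟩ := qp_bdd h1 (-1)
  obtain ⟨M, hM, h'⟩ := rq_bdd h1
  have key : Tendsto (fun r : ℕ => ∑' m : ℕ, (q ^ r) ^ m *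
      (qp q (-1) (m + r) * q ^ (m * (m + 1) / 2) * rq q m * rq q ((m + 2 * r : ℕ) : ℤ))) atTop
      (𝓝 (∑' m : ℕ, (0 : ℂ) ^ m *
        (qpInf q (-1) * q ^ (m * (m + 1) / 2) * rq q m * (qpInf q q)⁻¹))) := by
    refine tendsto_tsum_of_dominated_convergence (bound := fun m => K * ‖q‖ ^ m * M * M)
      ((((summable_geometric_of_lt_one (norm_nonneg q) h1).mul_left K).mul_right M).mul_right M)
      (fun m => ?_) (Eventually.of_forall fun r m => ?_)
    · refine (hq0.pow m).mul ((((Tendsto.mul_const _ ?_)).mul_const _).mul ?_)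
      · exact (qp_tendsto h1 (-1)).comp (tendsto_atTop_mono (fun r => by simp) tendsto_id)
      · exact (rq_tendsto h1).comp (tendsto_atTop_mono (fun r => by simp; omega) tendsto_id)
    · have b1 : ‖(q ^ r) ^ m‖ ≤ 1 := by
        rw [norm_pow, norm_pow]; exact pow_le_one₀ (by positivity) (pow_le_one₀ (by positivity) h1.le)
      have b2 : ‖q ^ (m * (m + 1) / 2)‖ ≤ ‖q‖ ^ m := by
        rw [norm_pow]; exact pow_le_pow_of_le_one (norm_nonneg _) h1.le (le_tri m)
      rw [norm_mul, norm_mul, norm_mul, norm_mul]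
      refine (mul_le_mul b1 (mul_le_mul (mul_le_mul (mul_le_mul (h _) b2 ?_ ?_) (h' _) ?_ ?_) (h' _)
        ?_ ?_) ?_ ?_).trans_eq (one_mul _) <;> positivity
  rw [tsum_eq_single 0 (fun m hm => by simp [hm])] at key
  have h2 := (hq0.const_add 1).mul key
  have e : (1 + 0) * ((0 : ℂ) ^ 0 * (qpInf q (-1) * q ^ (0 * (0 + 1) / 2) * rq q (0 : ℕ) * (qpInf q q)⁻¹))
      = qpInf q (-1) * (qpInf q q)⁻¹ := by
    rw [rq_nat]; simp [qp]
  rw [e] at h2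
  exact h2.congr fun r => (T_nat hq h1 r).symm

lemma qpInf_neg_one {q : ℂ} (h1 : ‖q‖ < 1) : qpInf q (-1) = 2 * qpInf q (-q) := by
  refine tendsto_nhds_unique ((tendsto_add_atTop_iff_nat 1).mpr (qp_tendsto h1 (-1))) ?_
  refine ((qp_tendsto h1 (-q)).const_mul 2).congr fun n => ?_
  rw [qp, qp, Finset.prod_range_succ', mul_comm]
  congr 1
  · exact Finset.prod_congr rfl fun i _ => by ring
  · norm_num

lemma one_add_ne {q : ℂ} (h1 : ‖q‖ < 1) (r : ℤ) : 1 + q ^ r ≠ 0 := by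
  intro h
  have h2 : q ^ r = -1 := by linear_combination h
  have h4 : ‖q‖ ^ r = 1 := by rw [← norm_zpow, h2]; simp
  rcases lt_trichotomy r 0 with hr | hr | hr
  · have := one_sub_zpow_ne (q := (‖q‖ : ℂ)) (by simpa using h1) (n := -r) (by omega)
    apply this
    rw [zpow_neg, ← Complex.ofReal_zpow, h4]; simp
  · subst hr; norm_num at h
  · have := one_sub_zpow_ne (q := (‖q‖ : ℂ)) (by simpa using h1) (n := r) (by omega)
    apply this
    rw [← Complex.ofReal_zpow, h4]; simp

lemma S_eq {q : ℂ} (hq : q ≠ 0) (h1 : ‖q‖ < 1) (r : ℤ) :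
    S q r = 2 * (qpInf q q / qpInf q (-q))⁻¹ * (q ^ (r * (r + 1) / 2) / (1 + q ^ r)) := by
  have hl := T_lim hq h1
  simp only [T_const hq h1] at hl
  have h0 := tendsto_nhds_unique tendsto_const_nhds hl
  rw [← T_const hq h1 r, T, qpInf_neg_one h1] at h0
  have := one_add_ne h1 r
  have := zpow_ne_zero (r * (r + 1) / 2) hq
  rw [inv_div, div_eq_mul_inv (qpInf q (-q)), ← mul_assoc, ← h0]
  field_simp

lemma summable_int_geo {s : ℝ} (h0 : 0 ≤ s) (h1 : s < 1) : Summable fun j : ℤ => s ^ j.natAbs := by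
  rw [summable_int_iff_summable_nat_and_neg]
  constructor <;> simpa using summable_geometric_of_lt_one h0 h1

lemma swap_summable {q : ℂ} (h1 : ‖q‖ < 1) (c : ℤ → ℂ) (hc : ∀ j, ‖c j‖ ≤ 2)
    (g : ℤ → ℤ) (hg : ∀ j, |j| ≤ |g j|) :
    Summable (Function.uncurry fun (n : ℕ) (j : ℤ) =>
      w q n * (c j * (rq q (n - g j) * rq q (n + g j)))) := by
  obtain ⟨K, hK, h⟩ := w_bdd h1
  obtain ⟨M, hM, h'⟩ := rq_bdd h1
  set s := Real.sqrt ‖q‖ with hs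
  have s0 : 0 ≤ s := Real.sqrt_nonneg _
  have s1 : s < 1 := by rw [hs, Real.sqrt_lt' one_pos]; simpa using h1
  have sq : ‖q‖ = s * s := (Real.mul_self_sqrt (norm_nonneg q)).symm
  have hb := ((summable_geometric_of_lt_one s0 s1).mul_of_nonneg (summable_int_geo s0 s1)
    (fun _ => by positivity) (fun _ => by positivity)).mul_left (K * (2 * (M * M)))
  refine Summable.of_norm_bounded hb ?_
  rintro ⟨n, j⟩
  simp only [Function.uncurry]
  by_cases hz : (n : ℤ) - g j < 0 ∨ (n : ℤ) + g j < 0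
  · rw [rqrq_zero q hz, mul_zero, mul_zero, norm_zero]; positivity
  · have hj : j.natAbs ≤ n := by
      have := hg j
      rw [abs_le'] at this
      rcases abs_cases (g j) with ⟨e, _⟩ | ⟨e, _⟩ <;> omega
    have hp : ‖q‖ ^ n ≤ s ^ n * s ^ j.natAbs := by
      rw [sq, mul_pow]
      exact mul_le_mul_of_nonneg_left (pow_le_pow_of_le_one s0 s1.le hj) (by positivity)
    rw [norm_mul, norm_mul, norm_mul]
    calc _ ≤ (K * ‖q‖ ^ n) * (2 * (M * M)) :=
          mul_le_mul (h n) (mul_le_mul (hc j) (mul_le_mul (h' _) (h' _) (norm_nonneg _) hM.le)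
            (by positivity) (by norm_num)) (by positivity) (by positivity)
      _ = K * (2 * (M * M)) * ‖q‖ ^ n := by ring
      _ ≤ _ := mul_le_mul_of_nonneg_left hp (by positivity)

lemma swap_eq {q : ℂ} (h1 : ‖q‖ < 1) (c : ℤ → ℂ) (hc : ∀ j, ‖c j‖ ≤ 2)
    (g : ℤ → ℤ) (hg : ∀ j, |j| ≤ |g j|) :
    ∑' n : ℕ, w q n * ∑' j : ℤ, c j * (rq q (n - g j) * rq q (n + g j)) = ∑' j, c j * S q (g j) := by
  have := (swap_summable h1 c hc g hg).tsum_comm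
  simp only [← tsum_mul_left]
  rw [← this]
  refine tsum_congr fun j => ?_
  rw [S, ← tsum_mul_left]
  exact tsum_congr fun n => by ring

lemma norm_zpow_le {q : ℂ} (h1 : ‖q‖ < 1) {n : ℤ} (hn : 0 ≤ n) : ‖q ^ n‖ ≤ 1 := by
  lift n to ℕ using hn
  rw [zpow_natCast, norm_pow]; exact pow_le_one₀ (norm_nonneg _) h1.le

lemma quad_nonneg (j : ℤ) : 0 ≤ 3 * j ^ 2 + 2 * j ∧ 0 ≤ 3 * j ^ 2 - j ∧ 0 ≤ 3 * j ^ 2 + j ∧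
    0 ≤ 3 * j ^ 2 + 4 * j + 1 := by
  have h : j ≤ -1 ∨ j = 0 ∨ 1 ≤ j := by omega
  rcases h with h | h | h
  · refine ⟨?_, ?_, ?_, ?_⟩ <;> nlinarith
  · subst h; simp
  · refine ⟨?_, ?_, ?_, ?_⟩ <;> nlinarith

lemma a3_le {q : ℂ} (h1 : ‖q‖ < 1) (j : ℤ) : ‖a3 q j‖ ≤ 2 := by
  obtain ⟨x, y, _, _⟩ := quad_nonneg j
  have := norm_zpow_le h1 x
  have := norm_zpow_le h1 y
  exact (norm_sub_le _ _).trans (by linarith)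

lemma b3_le {q : ℂ} (h1 : ‖q‖ < 1) (j : ℤ) : ‖b3 q j‖ ≤ 2 := by
  obtain ⟨_, _, x, y⟩ := quad_nonneg j
  have := norm_zpow_le h1 x
  have := norm_zpow_le h1 y
  exact (norm_sub_le _ _).trans (by linarith)

theorem stmt10 (q : ℂ) (h0 : 0 < ‖q‖) (h1 : ‖q‖ < 1) :
    ∑' n : ℕ, qp q (-q) n * q ^ ((3 * (n + 1) ^ 2 - (n + 1)) / 2) /
        ((1 + q ^ (n + 1)) * qp q q (2 * n + 1))
      = -(qpInf q q / qpInf q (-q))⁻¹ *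
            ∑' n : ℤ, (1 - q ^ (3 * n)) / (1 + q ^ (3 * n)) * q ^ ((15 * n ^ 2 + n) / 2)
        + (qpInf q q / qpInf q (-q))⁻¹ *
            ∑' n : ℤ, (1 - q ^ (3 * n + 1)) / (1 + q ^ (3 * n + 1)) *
              q ^ ((15 * n ^ 2 + 11 * n) / 2 + 1) := by
  have hq : q ≠ 0 := norm_pos_iff.mp h0
  have hg1 : ∀ j : ℤ, |j| ≤ |3 * j| := fun j => by
    rcases abs_cases j with ⟨e, _⟩ | ⟨e, _⟩ <;> rcases abs_cases (3 * j) with ⟨e', _⟩ | ⟨e', _⟩ <;> omega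
  have hg2 : ∀ j : ℤ, |j| ≤ |3 * j + 1| := fun j => by
    rcases abs_cases j with ⟨e, _⟩ | ⟨e, _⟩ <;> rcases abs_cases (3 * j + 1) with ⟨e', _⟩ | ⟨e', _⟩ <;> omega
  have E1 := swap_eq h1 (a3 q) (a3_le h1) (fun j => 3 * j) hg1
  have E2 := swap_eq h1 (b3 q) (b3_le h1) (fun j => 3 * j + 1) hg2
  have s1 := (swap_summable h1 (a3 q) (a3_le h1) (fun j => 3 * j) hg1).prod
  have s2 := (swap_summable h1 (b3 q) (b3_le h1) (fun j => 3 * j + 1) hg2).prod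
  simp only [Function.uncurry, tsum_mul_left] at s1 s2
  have E := congrArg₂ (· + ·) E1 E2
  have hs := s1.add s2
  rw [← s1.tsum_add s2] at E
  simp only [← mul_add, bailey hq h1] at E hs
  rw [hs.tsum_eq_zero_add] at E
  have L : ∀ n : ℕ, w q (n + 1) * (q ^ (((n + 1 : ℕ) : ℤ) ^ 2 - (n + 1 : ℕ)) * (1 - q ^ (n + 1)) *
      rq q (2 * (n + 1 : ℕ))) = 2 * (qp q (-q) n * q ^ ((3 * (n + 1) ^ 2 - (n + 1)) / 2) /
        ((1 + q ^ (n + 1)) * qp q q (2 * n + 1))) := by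
    intro n
    have x1 : qp q (-1) (n + 1) = 2 * qp q (-q) n := by
      rw [qp, qp, Finset.prod_range_succ', mul_comm]
      congr 1
      · norm_num
      · exact Finset.prod_congr rfl fun i _ => by ring
    have x2 : rq q (2 * (n + 1 : ℕ)) = (qp q q (2 * n + 1) * (1 - q ^ (n + 1) * q ^ (n + 1)))⁻¹ := by
      rw [show (2 * ((n + 1 : ℕ) : ℤ)) = ((2 * n + 1 + 1 : ℕ) : ℤ) by push_cast; ring, rq_nat, qp, qp,
        Finset.prod_range_succ]
      congr 3
      ring
    have x3 : ((n + 1 : ℕ) : ℤ) ^ 2 - (n + 1 : ℕ) = ((n * (n + 1) : ℕ) : ℤ) := by push_cast; ring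
    have x4 : (3 * (n + 1) ^ 2 - (n + 1)) / 2 = (n + 1) * (n + 1 + 1) / 2 + n * (n + 1) := by
      have := tri2 (n + 1)
      have y : 3 * (n + 1) ^ 2 - (n + 1) = ((n + 1) * (n + 1 + 1) / 2 + n * (n + 1)) * 2 := by
        rw [add_mul, this]
        apply Nat.sub_eq_of_eq_add
        ring
      rw [y, Nat.mul_div_cancel _ (by norm_num)]
    have x5 : 1 - q ^ (n + 1) ≠ 0 := by rw [pow_succ']; exact one_sub_pow_ne h1 n
    have x6 : 1 + q ^ (n + 1) ≠ 0 := by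
      have := one_add_ne h1 ((n + 1 : ℕ) : ℤ)
      rwa [zpow_natCast] at this
    have x7 := qp_ne h1 (2 * n + 1)
    rw [w, x1, x2, x3, x4, zpow_natCast, pow_add q ((n + 1) * (n + 1 + 1) / 2)]
    rw [show 1 - q ^ (n + 1) * q ^ (n + 1) = (1 - q ^ (n + 1)) * (1 + q ^ (n + 1)) by ring]
    field_simp
  rw [tsum_congr L, tsum_mul_left] at E
  have R1 : ∀ j : ℤ, a3 q j * S q (3 * j) = 2 * (-(qpInf q q / qpInf q (-q))⁻¹ *
      ((1 - q ^ (3 * j)) / (1 + q ^ (3 * j)) * q ^ ((15 * j ^ 2 + j) / 2))) := by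
    intro j
    have y : (15 * j ^ 2 + j) / 2 = 3 * j * (3 * j + 1) / 2 + (3 * j ^ 2 - j) := by
      rw [show 15 * j ^ 2 + j = 3 * j * (3 * j + 1) + (3 * j ^ 2 - j) * 2 by ring,
        Int.add_mul_ediv_right _ _ (by norm_num)]
    rw [S_eq hq h1, a3, y, zpow_add₀ hq (3 * j * (3 * j + 1) / 2),
      show 3 * j ^ 2 + 2 * j = 3 * j + (3 * j ^ 2 - j) by ring, zpow_add₀ hq (3 * j)]
    ring
  have R2 : ∀ j : ℤ, b3 q j * S q (3 * j + 1) = 2 * ((qpInf q q / qpInf q (-q))⁻¹ *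
      ((1 - q ^ (3 * j + 1)) / (1 + q ^ (3 * j + 1)) * q ^ ((15 * j ^ 2 + 11 * j) / 2 + 1))) := by
    intro j
    have y : (15 * j ^ 2 + 11 * j) / 2 + 1 = (3 * j + 1) * (3 * j + 1 + 1) / 2 + (3 * j ^ 2 + j) := by
      rw [show (3 * j + 1) * (3 * j + 1 + 1) = (15 * j ^ 2 + 11 * j) + (1 - (3 * j ^ 2 + j)) * 2 by ring,
        Int.add_mul_ediv_right _ _ (by norm_num)]
      ring
    rw [S_eq hq h1, b3, y, zpow_add₀ hq ((3 * j + 1) * (3 * j + 1 + 1) / 2),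
      show 3 * j ^ 2 + 4 * j + 1 = (3 * j + 1) + (3 * j ^ 2 + j) by ring, zpow_add₀ hq (3 * j + 1)]
    ring
  rw [tsum_congr R1, tsum_congr R2] at E
  simp only [tsum_mul_left] at E
  apply mul_left_cancel₀ (two_ne_zero (α := ℂ))
  rw [mul_add, ← E]
  simp
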